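/- Let q > 2, γ ∈ (0, γ_max), and let β be an arbitrary real number. Then M_q is differentiable at γ and M_q'(γ) = ∫_{t₁}^{t₂} (√(f(t))·f'(t) / Ψ(t)²) · H_β(t) dt. -/

import Mathlib

open Real Set Filter MeasureTheory

noncomputable section

/-- `f(t) = t - γ·t^{q/2+1} - 1`. -/
def f (q γ : ℝ) : ℝ → ℝ := fun t => t - γ * t ^ (q / 2 + 1) - 1

/-- `γ_max = (2/(q+2))·(1 + 2/q)^{-q/2}`. -/
def gammaMax (q : ℝ) : ℝ := 2 / (q + 2) * (1 + 2 / q) ^ (-(q / 2))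

/-- The hypothesis that `t₁ γ < t₂ γ` are the two positive zeros of `f(q, γ, ·)`
for every `γ ∈ (0, γ_max)`. -/
def AreRoots (q : ℝ) (t₁ t₂ : ℝ → ℝ) : Prop :=
  ∀ γ ∈ Ioo 0 (gammaMax q),
    0 < t₁ γ ∧ t₁ γ < t₂ γ ∧ f q γ (t₁ γ) = 0 ∧ f q γ (t₂ γ) = 0 ∧
      ∀ t, 0 < t → f q γ t = 0 → t = t₁ γ ∨ t = t₂ γ

/-- The hypothesis that `M γ = ∫_{t₁ γ}^{t₂ γ} dt/(t·√(f t))` for every `γ ∈ (0, γ_max)`. -/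
def IsM (q : ℝ) (t₁ t₂ M : ℝ → ℝ) : Prop :=
  ∀ γ ∈ Ioo 0 (gammaMax q),
    M γ = ∫ t in (t₁ γ)..(t₂ γ), 1 / (t * Real.sqrt (f q γ t))

/-- `f' `. -/
def f1 (q γ : ℝ) : ℝ → ℝ := deriv (f q γ)

/-- `f''`. -/
def f2 (q γ : ℝ) : ℝ → ℝ := deriv (f1 q γ)

/-- `f'''`. -/
def f3 (q γ : ℝ) : ℝ → ℝ := deriv (f2 q γ)

/-- `Ψ = f'² - 2ff''`. -/
def Psi (q γ : ℝ) : ℝ → ℝ := fun t => f1 q γ t ^ 2 - 2 * f q γ t * f2 q γ t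

/-- `H_β = β(3f'²f'' + 2ff'f''' - 6ff''²) - q(q-2)t^{q/2-2}/2`. -/
def Hb (q γ β : ℝ) : ℝ → ℝ := fun t =>
  β * (3 * f1 q γ t ^ 2 * f2 q γ t + 2 * f q γ t * f1 q γ t * f3 q γ t -
      6 * f q γ t * f2 q γ t ^ 2) -
    q * (q - 2) * t ^ (q / 2 - 2) / 2

/-- Differentiation under the integral sign with a jointly continuous derivative. -/
theorem aux_param (F F' : ℝ → ℝ → ℝ) (a b x₀ δ : ℝ) (hδ : 0 < δ) (hab : a ≤ b)
    (hF : ∀ x ∈ Icc (x₀ - δ) (x₀ + δ), ContinuousOn (F x) (Icc a b))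
    (hF' : ContinuousOn (fun z : ℝ × ℝ => F' z.1 z.2) (Icc (x₀ - δ) (x₀ + δ) ×ˢ Icc a b))
    (hd : ∀ x ∈ Icc (x₀ - δ) (x₀ + δ), ∀ t ∈ Icc a b, HasDerivAt (fun x => F x t) (F' x t) x) :
    HasDerivAt (fun x => ∫ t in a..b, F x t) (∫ t in a..b, F' x₀ t) x₀ := by
  have hs : Icc (x₀ - δ) (x₀ + δ) ∈ nhds x₀ := Icc_mem_nhds (by linarith) (by linarith)
  have hx0 : x₀ ∈ Icc (x₀ - δ) (x₀ + δ) := ⟨by linarith, by linarith⟩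
  obtain ⟨C, hC⟩ := (isCompact_Icc.prod isCompact_Icc).exists_bound_of_continuousOn hF'
  have hu : uIoc a b ⊆ Icc a b := by rw [uIoc_of_le hab]; exact Ioc_subset_Icc_self
  have hF0 : ContinuousOn (F' x₀) (Icc a b) :=
    hF'.comp (f := fun t : ℝ => (x₀, t)) (by fun_prop) (fun t ht => ⟨hx0, ht⟩)
  refine (intervalIntegral.hasDerivAt_integral_of_dominated_loc_of_deriv_le
    (bound := fun _ => C) hs ?_ ?_ ?_ ?_ ?_ ?_).2
  · filter_upwards [hs] with x hx
    exact ((hF x hx).mono hu).aestronglyMeasurable measurableSet_uIoc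
  · exact ((hF x₀ hx0).mono (by rw [uIcc_of_le hab])).intervalIntegrable
  · exact (hF0.mono hu).aestronglyMeasurable measurableSet_uIoc
  · exact Eventually.of_forall fun t ht x hx => hC (x, t) ⟨hx, hu ht⟩
  · exact intervalIntegrable_const
  · exact Eventually.of_forall fun t ht x hx => hd x hx t (hu ht)

theorem aux_sqrt32 (y : ℝ) : HasDerivAt (fun y : ℝ => y * √y) (3 / 2 * √y) y := by
  rcases lt_trichotomy y 0 with h | h | h
  · have : (fun y : ℝ => y * √y) =ᶠ[nhds y] fun _ => 0 := by
      filter_upwards [Iio_mem_nhds h] with z hz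
      rw [Real.sqrt_eq_zero_of_nonpos (le_of_lt hz), mul_zero]
    rw [Real.sqrt_eq_zero_of_nonpos h.le, mul_zero]
    exact (hasDerivAt_const y (0 : ℝ)).congr_of_eventuallyEq this
  · subst h
    rw [hasDerivAt_iff_tendsto_slope_zero]
    have : Tendsto (fun t : ℝ => √t) (nhdsWithin 0 {0}ᶜ) (nhds (√0)) :=
      (Real.continuous_sqrt.tendsto 0).mono_left nhdsWithin_le_nhds
    simp only [Real.sqrt_zero, mul_zero, zero_add, sub_zero, smul_eq_mul] at this ⊢
    refine this.congr' ?_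
    filter_upwards [self_mem_nhdsWithin] with t ht
    have : t ≠ 0 := ht
    field_simp
  · have h1 := (hasDerivAt_id y).mul ((hasDerivAt_id y).sqrt h.ne')
    refine h1.congr_deriv ?_
    have h2 : √y ≠ 0 := (Real.sqrt_pos.2 h).ne'
    have h3 : √y * √y = y := Real.mul_self_sqrt h.le
    simp only [id]
    field_simp
    nlinarith [h3]

/-- The left end of the integral. -/
theorem aux_left (φ φ' g g' k h w Q T τ : ℝ → ℝ) (a c x₀ : ℝ)
    (hφ : ∀ t ∈ Icc a c, HasDerivAt φ (φ' t) t)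
    (hg : ∀ t ∈ Icc a c, HasDerivAt g (g' t) t)
    (hk : ∀ t ∈ Icc a c, HasDerivAt k (h t) t)
    (hpos : ∀ t ∈ Icc a c, 0 < φ' t)
    (hw : ∀ t ∈ Icc a c, w t = g t * φ' t)
    (hgk : ∀ t ∈ Icc a c, g' t = k t * φ' t)
    (hh : ContinuousOn h (Icc a c))
    (hτ : ∀ᶠ x in nhds x₀, a < τ x ∧ τ x < c ∧ φ (τ x) = x)
    (hQ : ∀ t ∈ Ioc (τ x₀) c, HasDerivAt Q (w t / (2 * (φ t - x₀) * √(φ t - x₀)) - T t) t)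
    (hT : ContinuousOn T (Icc (τ x₀) c))
    (hlim : Tendsto (fun t => g t / √(φ t - x₀) + Q t) (nhdsWithin (τ x₀) (Ioi (τ x₀))) (nhds 0)) :
    (∀ᶠ x in nhds x₀, IntervalIntegrable (fun t => w t / √(φ t - x)) volume (τ x) c) ∧
    HasDerivAt (fun x => ∫ t in (τ x)..c, w t / √(φ t - x)) ((∫ t in (τ x₀)..c, T t) + Q c) x₀ := by
  have hφc : ContinuousOn φ (Icc a c) := fun t ht => (hφ t ht).continuousAt.continuousWithinAt
  have hgc : ContinuousOn g (Icc a c) := fun t ht => (hg t ht).continuousAt.continuousWithinAt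
  have hkc : ContinuousOn k (Icc a c) := fun t ht => (hk t ht).continuousAt.continuousWithinAt
  have hmono : StrictMonoOn φ (Icc a c) := by
    refine strictMonoOn_of_deriv_pos (convex_Icc a c) hφc fun t ht => ?_
    rw [interior_Icc] at ht
    rw [(hφ t (Ioo_subset_Icc_self ht)).deriv]
    exact hpos t (Ioo_subset_Icc_self ht)
  have hyp : ∀ x, a < τ x ∧ τ x < c ∧ φ (τ x) = x → ∀ t ∈ Ioc (τ x) c, 0 < φ t - x := by
    intro x ⟨h1, h2, h3⟩ t ht
    have := hmono ⟨h1.le, h2.le⟩ ⟨(h1.trans ht.1).le, ht.2⟩ ht.1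
    rw [h3] at this; linarith
  have hint : ∀ x, a < τ x ∧ τ x < c ∧ φ (τ x) = x →
      IntervalIntegrable (fun t => w t / √(φ t - x)) volume (τ x) c := by
    intro x hx
    have hsub : Icc (τ x) c ⊆ Icc a c := Icc_subset_Icc_left hx.1.le
    have h1 : IntervalIntegrable (fun t => φ' t / (2 * √(φ t - x))) volume (τ x) c := by
      refine intervalIntegral.intervalIntegrable_deriv_of_nonneg (g := fun t => √(φ t - x)) ?_ ?_ ?_
      · rw [uIcc_of_le hx.2.1.le]
        exact ((hφc.mono hsub).sub continuousOn_const).sqrt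
      · rw [min_eq_left hx.2.1.le, max_eq_right hx.2.1.le]
        intro t ht
        exact ((hφ t (hsub (Ioo_subset_Icc_self ht))).sub_const x).sqrt
          (hyp x hx t (Ioo_subset_Ioc_self ht)).ne'
      · rw [min_eq_left hx.2.1.le, max_eq_right hx.2.1.le]
        intro t ht
        have := hpos t (hsub (Ioo_subset_Icc_self ht))
        positivity
    have h2 := (h1.mul_continuousOn (g := fun t => 2 * g t) (by
      rw [uIcc_of_le hx.2.1.le]; exact continuousOn_const.mul (hgc.mono hsub)))
    refine h2.congr ?_
    rw [uIoc_of_le hx.2.1.le]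
    intro t ht
    have h3 := (Real.sqrt_pos.2 (hyp x hx t ht)).ne'
    simp only
    rw [hw t (hsub (Ioc_subset_Icc_self ht))]
    field_simp
  refine ⟨hτ.mono hint, ?_⟩
  have hx0 := hτ.self_of_nhds
  have hac : a ≤ c := (hx0.1.trans hx0.2.1).le
  have hcm : c ∈ Icc a c := ⟨hac, le_rfl⟩
  have hzero : ∀ x, a < τ x ∧ τ x < c ∧ φ (τ x) = x → ∀ t ∈ Icc a (τ x), √(φ t - x) = 0 := by
    intro x hx t ht
    apply Real.sqrt_eq_zero_of_nonpos
    have := hmono.monotoneOn ⟨ht.1, ht.2.trans hx.2.1.le⟩ ⟨hx.1.le, hx.2.1.le⟩ ht.2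
    rw [hx.2.2] at this; linarith
  -- representation of the integral by a regular one
  have hrep : ∀ x, a < τ x ∧ τ x < c ∧ φ (τ x) = x →
      ∫ t in (τ x)..c, w t / √(φ t - x) =
        2 * g c * √(φ c - x) - 4 / 3 * k c * ((φ c - x) * √(φ c - x))
          + 4 / 3 * ∫ t in a..c, (φ t - x) * √(φ t - x) * h t := by
    intro x hx
    have hsub : Icc (τ x) c ⊆ Icc a c := Icc_subset_Icc_left hx.1.le
    have hc1 : ContinuousOn (fun t => (φ t - x) * √(φ t - x) * h t) (Icc a c) :=
      ((hφc.sub continuousOn_const).mul (hφc.sub continuousOn_const).sqrt).mul hh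
    have hi1 : IntervalIntegrable (fun t => (φ t - x) * √(φ t - x) * h t) volume (τ x) c :=
      (hc1.mono (by rw [uIcc_of_le hx.2.1.le]; exact hsub)).intervalIntegrable
    have hi0 : IntervalIntegrable (fun t => (φ t - x) * √(φ t - x) * h t) volume a (τ x) :=
      (hc1.mono (by rw [uIcc_of_le hx.1.le]; exact Icc_subset_Icc_right hx.2.1.le)).intervalIntegrable
    have hz : ∫ t in a..(τ x), (φ t - x) * √(φ t - x) * h t = 0 := by
      rw [intervalIntegral.integral_congr (g := fun _ => 0), intervalIntegral.integral_zero]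
      intro t ht
      rw [uIcc_of_le hx.1.le] at ht
      simp [hzero x hx t ht]
    rw [← intervalIntegral.integral_add_adjacent_intervals hi0 hi1, hz, zero_add]
    have hftc := intervalIntegral.integral_eq_sub_of_hasDerivAt_of_le
      (f := fun t => 2 * g t * √(φ t - x) - 4 / 3 * k t * ((φ t - x) * √(φ t - x)))
      (f' := fun t => w t / √(φ t - x) - 4 / 3 * ((φ t - x) * √(φ t - x) * h t))
      hx.2.1.le ?_ ?_ ((hint x hx).sub (hi1.const_mul _))
    · rw [intervalIntegral.integral_sub (hint x hx) (hi1.const_mul _),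
        intervalIntegral.integral_const_mul] at hftc
      rw [hx.2.2] at hftc
      simp only [sub_self, Real.sqrt_zero, mul_zero, sub_zero] at hftc
      linarith
    · have e1 := hgc.mono hsub
      have e2 := hkc.mono hsub
      have e3 := (hφc.mono hsub).sub (continuousOn_const (c := x))
      exact ((continuousOn_const.mul e1).mul e3.sqrt).sub
        ((continuousOn_const.mul e2).mul (e3.mul e3.sqrt))
    · intro t ht
      have htm := hsub (Ioo_subset_Icc_self ht)
      have hy := hyp x hx t (Ioo_subset_Ioc_self ht)
      have d0 := (hφ t htm).sub_const x
      have d1 := ((hg t htm).const_mul 2).mul (d0.sqrt hy.ne')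
      have d2 := ((hk t htm).const_mul (4 / 3)).mul ((aux_sqrt32 (φ t - x)).comp t d0)
      refine (d1.sub d2).congr_deriv ?_
      have h3 := (Real.sqrt_pos.2 hy).ne'
      rw [hw t htm, hgk t htm]
      simp only [Function.comp]
      field_simp
      ring
  have hy0 : 0 < φ c - x₀ := hyp x₀ hx0 c ⟨hx0.2.1, le_rfl⟩
  have hs0 : √(φ c - x₀) ≠ 0 := (Real.sqrt_pos.2 hy0).ne'
  have hder : HasDerivAt (fun x => 2 * g c * √(φ c - x) - 4 / 3 * k c * ((φ c - x) * √(φ c - x))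
          + 4 / 3 * ∫ t in a..c, (φ t - x) * √(φ t - x) * h t)
      (- g c / √(φ c - x₀) + 2 * k c * √(φ c - x₀)
        + 4 / 3 * ∫ t in a..c, -(3 / 2 * √(φ t - x₀)) * h t) x₀ := by
    have d0 : HasDerivAt (fun x => φ c - x) (-1) x₀ := by
      simpa using (hasDerivAt_id x₀).const_sub (φ c)
    have d1 := (d0.sqrt hy0.ne').const_mul (2 * g c)
    have d2 := ((aux_sqrt32 (φ c - x₀)).comp x₀ d0).const_mul (4 / 3 * k c)
    have d3 := aux_param (fun x t => (φ t - x) * √(φ t - x) * h t)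
      (fun x t => -(3 / 2 * √(φ t - x)) * h t) a c x₀ 1 one_pos hac ?_ ?_ ?_
    · refine ((d1.sub d2).add (d3.const_mul (4 / 3))).congr_deriv ?_
      field_simp
      ring
    · intro x _
      exact ((hφc.sub continuousOn_const).mul (hφc.sub continuousOn_const).sqrt).mul hh
    · have p1 : ContinuousOn (fun z : ℝ × ℝ => φ z.2) (Icc (x₀ - 1) (x₀ + 1) ×ˢ Icc a c) :=
        hφc.comp continuousOn_snd (fun z hz => hz.2)
      have p2 : ContinuousOn (fun z : ℝ × ℝ => h z.2) (Icc (x₀ - 1) (x₀ + 1) ×ˢ Icc a c) :=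
        hh.comp continuousOn_snd (fun z hz => hz.2)
      exact ((continuousOn_const.mul (p1.sub continuousOn_fst).sqrt).neg).mul p2
    · intro x _ t _
      have d0 : HasDerivAt (fun x => φ t - x) (-1) x := by
        simpa using (hasDerivAt_id x).const_sub (φ t)
      refine (((aux_sqrt32 (φ t - x)).comp x d0).mul_const (h t)).congr_deriv ?_
      ring
  refine (hder.congr_of_eventuallyEq (hτ.mono hrep)).congr_deriv ?_
  -- evaluation
  have hsub : Icc (τ x₀) c ⊆ Icc a c := Icc_subset_Icc_left hx0.1.le
  have hc1 : ContinuousOn (fun t => -(3 / 2 * √(φ t - x₀)) * h t) (Icc a c) :=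
    (continuousOn_const.mul (hφc.sub continuousOn_const).sqrt).neg.mul hh
  have hi1 : IntervalIntegrable (fun t => -(3 / 2 * √(φ t - x₀)) * h t) volume (τ x₀) c :=
    (hc1.mono (by rw [uIcc_of_le hx0.2.1.le]; exact hsub)).intervalIntegrable
  have hi0 : IntervalIntegrable (fun t => -(3 / 2 * √(φ t - x₀)) * h t) volume a (τ x₀) :=
    (hc1.mono (by rw [uIcc_of_le hx0.1.le]; exact Icc_subset_Icc_right hx0.2.1.le)).intervalIntegrable
  have hz : ∫ t in a..(τ x₀), -(3 / 2 * √(φ t - x₀)) * h t = 0 := by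
    rw [intervalIntegral.integral_congr (g := fun _ => 0), intervalIntegral.integral_zero]
    intro t ht
    rw [uIcc_of_le hx0.1.le] at ht
    simp [hzero x₀ hx0 t ht]
  rw [← intervalIntegral.integral_add_adjacent_intervals hi0 hi1, hz, zero_add]
  have hTi : IntervalIntegrable T volume (τ x₀) c :=
    (hT.mono (by rw [uIcc_of_le hx0.2.1.le])).intervalIntegrable
  have hV : ∀ t ∈ Ioc (τ x₀) c,
      HasDerivAt (fun t => (-2) * (√(φ t - x₀) * k t) + (g t / √(φ t - x₀) + Q t))
        (4 / 3 * (-(3 / 2 * √(φ t - x₀)) * h t) - T t) t := by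
    intro t ht
    have htm := hsub (Ioc_subset_Icc_self ht)
    have hy := hyp x₀ hx0 t ht
    have hs : √(φ t - x₀) ≠ 0 := (Real.sqrt_pos.2 hy).ne'
    have d0 := ((hφ t htm).sub_const x₀).sqrt hy.ne'
    have d1 := (d0.mul (hk t htm)).const_mul (-2)
    have d2 := ((hg t htm).div d0 hs).add (hQ t ht)
    refine (d1.add d2).congr_deriv ?_
    rw [hw t htm, hgk t htm]
    have h3 : φ t - x₀ = √(φ t - x₀) * √(φ t - x₀) := (Real.mul_self_sqrt hy.le).symm
    generalize √(φ t - x₀) = s at *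
    rw [h3]
    field_simp
    ring
  have hftc := intervalIntegral.integral_eq_sub_of_hasDerivAt_of_tendsto hx0.2.1
    (fun t ht => hV t (Ioo_subset_Ioc_self ht)) ((hi1.const_mul _).sub hTi)
    (fa := (-2) * (√(φ (τ x₀) - x₀) * k (τ x₀)) + 0)
    (fb := (-2) * (√(φ c - x₀) * k c) + (g c / √(φ c - x₀) + Q c)) ?_ ?_
  · rw [intervalIntegral.integral_sub (hi1.const_mul _) hTi,
        intervalIntegral.integral_const_mul, hx0.2.2] at hftc
    simp only [sub_self, Real.sqrt_zero, mul_zero, zero_mul, sub_zero, add_zero] at hftc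
    have e : 4 / 3 * ∫ t in (τ x₀)..c, -(3 / 2 * √(φ t - x₀)) * h t
      = -2 * (√(φ c - x₀) * k c) + (g c / √(φ c - x₀) + Q c) + ∫ t in (τ x₀)..c, T t := by linarith
    rw [e]; ring
  · refine Tendsto.add ?_ hlim
    have htm : τ x₀ ∈ Icc a c := ⟨hx0.1.le, hx0.2.1.le⟩
    have e1 := (((hφ _ htm).continuousAt.sub continuousAt_const).sqrt (f := fun t => φ t - x₀)).mul (hk _ htm).continuousAt
    exact (tendsto_const_nhds.mul e1.tendsto).mono_left nhdsWithin_le_nhds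
  · exact (hV c ⟨hx0.2.1, le_rfl⟩).continuousAt.tendsto.mono_left nhdsWithin_le_nhds

/-- The right end, by reflection. -/
theorem aux_right (φ φ' g g' k h w Q T τ : ℝ → ℝ) (b d x₀ : ℝ)
    (hφ : ∀ t ∈ Icc d b, HasDerivAt φ (φ' t) t)
    (hg : ∀ t ∈ Icc d b, HasDerivAt g (g' t) t)
    (hk : ∀ t ∈ Icc d b, HasDerivAt k (h t) t)
    (hneg : ∀ t ∈ Icc d b, φ' t < 0)
    (hw : ∀ t ∈ Icc d b, w t = g t * φ' t)
    (hgk : ∀ t ∈ Icc d b, g' t = k t * φ' t)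
    (hh : ContinuousOn h (Icc d b))
    (hτ : ∀ᶠ x in nhds x₀, d < τ x ∧ τ x < b ∧ φ (τ x) = x)
    (hQ : ∀ t ∈ Ico d (τ x₀), HasDerivAt Q (w t / (2 * (φ t - x₀) * √(φ t - x₀)) - T t) t)
    (hT : ContinuousOn T (Icc d (τ x₀)))
    (hlim : Tendsto (fun t => g t / √(φ t - x₀) + Q t) (nhdsWithin (τ x₀) (Iio (τ x₀))) (nhds 0)) :
    (∀ᶠ x in nhds x₀, IntervalIntegrable (fun t => w t / √(φ t - x)) volume d (τ x)) ∧
    HasDerivAt (fun x => ∫ t in d..(τ x), w t / √(φ t - x)) ((∫ t in d..(τ x₀), T t) - Q d) x₀ := by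
  have hm : ∀ {u v t : ℝ}, t ∈ Icc (-u) (-v) → -t ∈ Icc v u := by
    intro u v t ht; exact ⟨by linarith [ht.2], by linarith [ht.1]⟩
  have hn : ∀ (F : ℝ → ℝ) (F' t : ℝ), HasDerivAt F F' (-t) → HasDerivAt (fun s => F (-s)) (-F') t := by
    intro F F' t hF
    exact (hF.comp t (hasDerivAt_neg t)).congr_deriv (by ring)
  have hnn : ∀ (F : ℝ → ℝ) (F' t : ℝ), HasDerivAt F F' (-t) → HasDerivAt (fun s => -F (-s)) F' t := by
    intro F F' t hF
    exact (hn F F' t hF).neg.congr_deriv (by ring)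
  have key := aux_left (fun s => φ (-s)) (fun s => -φ' (-s)) (fun s => -g (-s)) (fun s => g' (-s))
    (fun s => -k (-s)) (fun s => h (-s)) (fun s => w (-s)) (fun s => -Q (-s)) (fun s => T (-s))
    (fun x => -τ x) (-b) (-d) x₀
    (fun t ht => hn _ _ _ (hφ _ (hm ht)))
    (fun t ht => hnn _ _ _ (hg _ (hm ht)))
    (fun t ht => hnn _ _ _ (hk _ (hm ht)))
    (fun t ht => by simpa using hneg _ (hm ht))
    (fun t ht => by rw [hw _ (hm ht)]; ring)
    (fun t ht => by rw [hgk _ (hm ht)]; ring)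
    (hh.comp continuousOn_neg (fun t ht => hm ht))
    (hτ.mono fun x hx => ⟨by linarith [hx.2.1], by linarith [hx.1], by simpa using hx.2.2⟩)
    (fun t ht => hnn _ _ _ (hQ (-t) ⟨by linarith [ht.2], by linarith [ht.1]⟩))
    (hT.comp continuousOn_neg (fun t ht => hm ht))
    (by
      have h1 : Tendsto (fun s : ℝ => -s) (nhdsWithin (-τ x₀) (Ioi (-τ x₀)))
          (nhdsWithin (τ x₀) (Iio (τ x₀))) := by
        simpa using tendsto_neg_nhdsGT (a := -τ x₀)
      have h2 := (hlim.comp h1).neg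
      rw [neg_zero] at h2
      refine h2.congr fun t => ?_
      simp only [Function.comp]
      ring)
  refine ⟨key.1.mono fun x hx => ?_, ?_⟩
  · have := (IntervalIntegrable.iff_comp_neg).1 hx
    simpa using this.symm
  · have h2 := key.2
    have e : ∀ x, ∫ t in (-τ x)..(-d), w (-t) / √(φ (-t) - x) = ∫ t in d..(τ x), w t / √(φ t - x) := by
      intro x
      rw [intervalIntegral.integral_comp_neg (fun t => w t / √(φ t - x))]
      simp
    simp only [e] at h2
    rw [intervalIntegral.integral_comp_neg (fun t => T t)] at h2
    simpa [sub_eq_add_neg] using h2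

/-- `φ(t) = (t-1) t^{-p}`, `p = q/2+1`. -/
def phiA (q t : ℝ) : ℝ := (t - 1) * t ^ (-(q / 2 + 1))

/-- Its derivative. -/
def phiB (q t : ℝ) : ℝ := t ^ (-(q / 2 + 1) - 1) * ((q / 2 + 1) - q / 2 * t)

/-- The weight. -/
def wA (q t : ℝ) : ℝ := t ^ (-1 - (q / 2 + 1) / 2)

/-- The primitive. -/
def QA (q γ β t : ℝ) : ℝ :=
  (-(t ^ (q / 2)) * f1 q γ t + 2 * (q / 2 * t ^ (q / 2 - 1)) * f q γ t) /
    (√(f q γ t) * Psi q γ t) - 2 * β * (f q γ t * √(f q γ t) * f2 q γ t) / Psi q γ t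

theorem hd_rpow (r t : ℝ) (ht : 0 < t) : HasDerivAt (fun t : ℝ => t ^ r) (r * t ^ (r - 1)) t :=
  Real.hasDerivAt_rpow_const (Or.inl ht.ne')

theorem hd_f (q γ t : ℝ) (ht : 0 < t) :
    HasDerivAt (f q γ) (1 - γ * (q / 2 + 1) * t ^ (q / 2)) t := by
  have h := ((hasDerivAt_id t).sub ((hd_rpow (q / 2 + 1) t ht).const_mul γ)).sub_const 1
  refine h.congr_deriv ?_
  rw [add_sub_cancel_right]; ring

theorem f1_eq (q γ t : ℝ) (ht : 0 < t) : f1 q γ t = 1 - γ * (q / 2 + 1) * t ^ (q / 2) :=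
  (hd_f q γ t ht).deriv

theorem hd_f1 (q γ t : ℝ) (ht : 0 < t) :
    HasDerivAt (f1 q γ) (-(γ * (q / 2 + 1)) * (q / 2 * t ^ (q / 2 - 1))) t := by
  have h := ((hd_rpow (q / 2) t ht).const_mul (γ * (q / 2 + 1))).const_sub 1
  refine (h.congr_of_eventuallyEq ?_).congr_deriv (by ring)
  filter_upwards [Ioi_mem_nhds ht] with s hs using f1_eq q γ s hs

theorem f2_eq (q γ t : ℝ) (ht : 0 < t) :
    f2 q γ t = -(γ * (q / 2 + 1)) * (q / 2 * t ^ (q / 2 - 1)) :=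
  (hd_f1 q γ t ht).deriv

theorem hd_B (q t : ℝ) (ht : 0 < t) :
    HasDerivAt (fun t : ℝ => q / 2 * t ^ (q / 2 - 1)) (q / 2 * (q / 2 - 1) * t ^ (q / 2 - 2)) t := by
  refine ((hd_rpow (q / 2 - 1) t ht).const_mul (q / 2)).congr_deriv ?_
  rw [show q / 2 - 1 - 1 = q / 2 - 2 by ring]; ring

theorem hd_f2 (q γ t : ℝ) (ht : 0 < t) :
    HasDerivAt (f2 q γ) (-(γ * (q / 2 + 1)) * (q / 2 * (q / 2 - 1) * t ^ (q / 2 - 2))) t := by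
  refine ((hd_B q t ht).const_mul (-(γ * (q / 2 + 1)))).congr_of_eventuallyEq ?_
  filter_upwards [Ioi_mem_nhds ht] with s hs using f2_eq q γ s hs

theorem f3_eq (q γ t : ℝ) (ht : 0 < t) :
    f3 q γ t = -(γ * (q / 2 + 1)) * (q / 2 * (q / 2 - 1) * t ^ (q / 2 - 2)) :=
  (hd_f2 q γ t ht).deriv

theorem hd_Psi (q γ t : ℝ) (ht : 0 < t) :
    HasDerivAt (Psi q γ) (-2 * f q γ t * f3 q γ t) t := by
  have h := ((hd_f1 q γ t ht).pow 2).sub (((hd_f q γ t ht).const_mul 2).mul (hd_f2 q γ t ht))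
  refine h.congr_deriv ?_
  rw [f3_eq q γ t ht, f2_eq q γ t ht, f1_eq q γ t ht]
  push_cast
  ring

theorem f_eq (q γ t : ℝ) (ht : 0 < t) : f q γ t = t ^ (q / 2 + 1) * (phiA q t - γ) := by
  have h : t ^ (q / 2 + 1) * t ^ (-(q / 2 + 1)) = 1 := by
    rw [← Real.rpow_add ht]; simp
  unfold f phiA
  linear_combination (-(t - 1)) * h

theorem hd_phi (q t : ℝ) (ht : 0 < t) : HasDerivAt (phiA q) (phiB q t) t := by
  have h := ((hasDerivAt_id t).sub_const 1).mul (hd_rpow (-(q / 2 + 1)) t ht)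
  refine h.congr_deriv ?_
  have e : t ^ (-(q / 2 + 1)) = t ^ (-(q / 2 + 1) - 1) * t := by
    rw [Real.rpow_sub_one ht.ne']; field_simp
  unfold phiB
  simp only [id]
  rw [e]; ring

theorem D_eq (q γ t : ℝ) (ht : 0 < t) :
    t * f1 q γ t - (q / 2 + 1) * f q γ t = t ^ (q / 2 + 1) * t * phiB q t := by
  have h : t ^ (q / 2 + 1) * t * t ^ (-(q / 2 + 1) - 1) = 1 := by
    rw [Real.rpow_sub_one ht.ne', Real.rpow_neg ht.le]
    have := (Real.rpow_pos_of_pos ht (q / 2 + 1)).ne'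
    field_simp
  have e : t ^ (q / 2 + 1) = t ^ (q / 2) * t := Real.rpow_add_one ht.ne' _
  rw [f1_eq q γ t ht]
  unfold f phiB
  rw [e] at h ⊢
  linear_combination (-((q / 2 + 1) - q / 2 * t)) * h

theorem w_eq (q γ t : ℝ) (ht : 0 < t) :
    wA q t / √(phiA q t - γ) = 1 / (t * √(f q γ t)) := by
  have hp := Real.rpow_pos_of_pos ht ((q / 2 + 1) / 2)
  rw [f_eq q γ t ht, Real.sqrt_mul (Real.rpow_nonneg ht.le _), Real.sqrt_eq_rpow (t ^ (q / 2 + 1)),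
    ← Real.rpow_mul ht.le, show (q / 2 + 1) * (1 / 2) = (q / 2 + 1) / 2 by ring]
  unfold wA
  rw [Real.rpow_sub ht, Real.rpow_neg_one]
  simp only [div_eq_mul_inv, mul_inv, one_mul]
  ring

theorem Psi_pos (q γ t : ℝ) (hq : 2 < q) (hγ : 0 < γ) (ht : 0 < t) (hf : 0 ≤ f q γ t)
    (h : f q γ t = 0 → phiB q t ≠ 0) : 0 < Psi q γ t := by
  have h2 : f2 q γ t < 0 := by
    rw [f2_eq q γ t ht]
    have := Real.rpow_pos_of_pos ht (q / 2 - 1)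
    have : 0 < γ * (q / 2 + 1) * (q / 2 * t ^ (q / 2 - 1)) := by positivity
    linarith
  unfold Psi
  rcases hf.eq_or_lt with h0 | h0
  · have hD := D_eq q γ t ht
    rw [← h0] at hD ⊢
    have h3 : f1 q γ t ≠ 0 := by
      intro h4
      rw [h4] at hD
      have : t ^ (q / 2 + 1) * t * phiB q t ≠ 0 :=
        mul_ne_zero (mul_pos (Real.rpow_pos_of_pos ht _) ht).ne' (h h0.symm)
      apply this; rw [← hD]; ring
    have : 0 < f1 q γ t ^ 2 := by positivity
    linarith
  · nlinarith [sq_nonneg (f1 q γ t), mul_pos h0 (neg_pos.2 h2)]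

theorem alg_Q (s κ A B C β F1 F2 F3 P : ℝ) (hs : s ≠ 0) (h1 : F1 = 1 - κ * A) (h2 : F2 = -κ * B)
    (h3 : F3 = -κ * C) (hP : P = F1 ^ 2 - 2 * s ^ 2 * F2) (hP0 : P ≠ 0) :
    ((-B * F1 + -A * F2 + (2 * C * s ^ 2 + 2 * B * F1)) * (s * P) -
        (-A * F1 + 2 * B * s ^ 2) * (F1 / (2 * s) * P + s * (-2 * s ^ 2 * F3))) / (s * P) ^ 2
      - (2 * β * ((F1 * s + s ^ 2 * (F1 / (2 * s))) * F2 + s ^ 2 * s * F3) * P -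
        2 * β * (s ^ 2 * s * F2) * (-2 * s ^ 2 * F3)) / P ^ 2
    = A / (2 * s ^ 2 * s) - s * F1 / P ^ 2 *
      (β * (3 * F1 ^ 2 * F2 + 2 * s ^ 2 * F1 * F3 - 6 * s ^ 2 * F2 ^ 2) - 2 * C) := by
  have e1 : ((-B * F1 + -A * F2 + (2 * C * s ^ 2 + 2 * B * F1)) * (s * P) -
        (-A * F1 + 2 * B * s ^ 2) * (F1 / (2 * s) * P + s * (-2 * s ^ 2 * F3))) / (s * P) ^ 2
      = A / (2 * s ^ 2 * s) + 2 * C * s * F1 / P ^ 2 := by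
    field_simp
    rw [hP, h2, h3, h1]
    ring
  have e2 : (2 * β * ((F1 * s + s ^ 2 * (F1 / (2 * s))) * F2 + s ^ 2 * s * F3) * P -
        2 * β * (s ^ 2 * s * F2) * (-2 * s ^ 2 * F3)) / P ^ 2
      = s * F1 / P ^ 2 * (β * (3 * F1 ^ 2 * F2 + 2 * s ^ 2 * F1 * F3 - 6 * s ^ 2 * F2 ^ 2)) := by
    field_simp
    rw [hP]
    ring
  rw [e1, e2]; ring

theorem hd_Q (q γ β t : ℝ) (ht : 0 < t) (hf : 0 < f q γ t) (hP : 0 < Psi q γ t) :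
    HasDerivAt (QA q γ β) (wA q t / (2 * (phiA q t - γ) * √(phiA q t - γ)) -
      √(f q γ t) * f1 q γ t / Psi q γ t ^ 2 * Hb q γ β t) t := by
  have hs : √(f q γ t) ≠ 0 := (Real.sqrt_pos.2 hf).ne'
  have hff : √(f q γ t) ^ 2 = f q γ t := Real.sq_sqrt hf.le
  have d0 := hd_f q γ t ht
  rw [← f1_eq q γ t ht] at d0
  have d1 := hd_f1 q γ t ht
  rw [← f2_eq q γ t ht] at d1
  have d2 := hd_f2 q γ t ht
  rw [← f3_eq q γ t ht] at d2
  have dA := hd_rpow (q / 2) t ht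
  have dS := (dA.neg.mul d1).add (((hd_B q t ht).const_mul 2).mul d0)
  have ds := d0.sqrt hf.ne'
  have dP := hd_Psi q γ t ht
  have dQ1 := dS.div (ds.mul dP) (mul_ne_zero hs hP.ne')
  have dQ2 := (((d0.mul ds).mul d2).const_mul (2 * β)).div dP hP.ne'
  refine (dQ1.sub dQ2).congr_deriv ?_
  have hw : wA q t / (2 * (phiA q t - γ) * √(phiA q t - γ))
      = t ^ (q / 2) / (2 * √(f q γ t) ^ 2 * √(f q γ t)) := by
    have hy : 0 < phiA q t - γ := by
      rw [f_eq q γ t ht] at hf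
      exact (mul_pos_iff_of_pos_left (Real.rpow_pos_of_pos ht _)).1 hf
    have e : wA q t / (2 * (phiA q t - γ) * √(phiA q t - γ))
        = (wA q t / √(phiA q t - γ)) / (2 * (phiA q t - γ)) := by
      have := (Real.sqrt_pos.2 hy).ne'
      field_simp
    rw [e, w_eq q γ t ht, hff]
    have e2 := f_eq q γ t ht
    rw [Real.rpow_add_one ht.ne'] at e2
    have hA := (Real.rpow_pos_of_pos ht (q / 2)).ne'
    have e3 : phiA q t - γ = f q γ t / (t ^ (q / 2) * t) := by
      rw [e2]; field_simp
    rw [e3]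
    field_simp
  rw [hw]
  have key := alg_Q (√(f q γ t)) (γ * (q / 2 + 1)) (t ^ (q / 2)) (q / 2 * t ^ (q / 2 - 1))
    (q / 2 * (q / 2 - 1) * t ^ (q / 2 - 2)) β (f1 q γ t) (f2 q γ t) (f3 q γ t) (Psi q γ t) hs
    (f1_eq q γ t ht) (f2_eq q γ t ht) (f3_eq q γ t ht) (by rw [hff]; rfl) hP.ne'
  have hH : Hb q γ β t = β * (3 * f1 q γ t ^ 2 * f2 q γ t + 2 * √(f q γ t) ^ 2 * f1 q γ t * f3 q γ t
      - 6 * √(f q γ t) ^ 2 * f2 q γ t ^ 2) - 2 * (q / 2 * (q / 2 - 1) * t ^ (q / 2 - 2)) := by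
    rw [hff]; unfold Hb; ring
  rw [hH, ← key]
  simp only [Pi.mul_apply, Pi.add_apply, Pi.neg_apply, hff]
  try ring

theorem lim_Q (q γ β τ : ℝ) (hτ : 0 < τ) (hf : f q γ τ = 0) (hB : phiB q τ ≠ 0)
    (hP : 0 < Psi q γ τ) (l : Filter ℝ) (hl : l ≤ nhds τ) (hpos : ∀ᶠ t in l, 0 < f q γ t) :
    Tendsto (fun t => wA q t / phiB q t / √(phiA q t - γ) + QA q γ β t) l (nhds 0) := by
  have c0 := (hd_f q γ τ hτ).continuousAt
  have c1 := (hd_f1 q γ τ hτ).continuousAt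
  have c2 := (hd_f2 q γ τ hτ).continuousAt
  have cP := (hd_Psi q γ τ hτ).continuousAt
  have cA := (hd_rpow (q / 2) τ hτ).continuousAt
  have cB := (hd_B q τ hτ).continuousAt
  have ci : ContinuousAt (fun t : ℝ => t) τ := continuousAt_id
  have hD : τ * f1 q γ τ - (q / 2 + 1) * f q γ τ ≠ 0 := by
    rw [D_eq q γ τ hτ]
    exact mul_ne_zero (mul_pos (Real.rpow_pos_of_pos hτ _) hτ).ne' hB
  have cD : ContinuousAt (fun t => t * f1 q γ t - (q / 2 + 1) * f q γ t) τ :=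
    (ci.mul c1).sub (continuousAt_const.mul c0)
  have cR : ContinuousAt (fun t => √(f q γ t) * ((-2 * t * t ^ (q / 2) * f2 q γ t
      + (q / 2 + 1) * t ^ (q / 2) * f1 q γ t + 2 * t * (q / 2 * t ^ (q / 2 - 1)) * f1 q γ t
      - 2 * (q / 2 + 1) * (q / 2 * t ^ (q / 2 - 1)) * f q γ t) /
        (Psi q γ t * (t * f1 q γ t - (q / 2 + 1) * f q γ t))
      - 2 * β * (f q γ t * f2 q γ t) / Psi q γ t)) τ := by
    refine c0.sqrt.mul (ContinuousAt.sub (ContinuousAt.div ?_ (cP.mul cD) (mul_ne_zero hP.ne' hD))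
      (ContinuousAt.div (continuousAt_const.mul (c0.mul c2)) cP hP.ne'))
    exact (((((continuousAt_const.mul ci).mul cA).mul c2).add ((continuousAt_const.mul cA).mul c1)).add
      (((continuousAt_const.mul ci).mul cB).mul c1)).sub ((continuousAt_const.mul cB).mul c0)
  have hR := cR.tendsto.mono_left hl
  rw [hf, Real.sqrt_zero, zero_mul] at hR
  refine hR.congr' ?_
  filter_upwards [hpos, hl (Ioi_mem_nhds hτ), hl (cP.eventually_ne hP.ne'),
    hl (cD.eventually_ne hD)] with t h1 ht h3 h4
  have ht : 0 < t := ht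
  have hs : √(f q γ t) ≠ 0 := (Real.sqrt_pos.2 h1).ne'
  have hff : f q γ t = √(f q γ t) ^ 2 := (Real.sq_sqrt h1.le).symm
  rw [div_right_comm, w_eq q γ t ht]
  have hA := (Real.rpow_pos_of_pos ht (q / 2)).ne'
  have hDB := D_eq q γ t ht
  rw [Real.rpow_add_one ht.ne'] at hDB
  have hB' : phiB q t = (t * f1 q γ t - (q / 2 + 1) * f q γ t) / (t ^ (q / 2) * t * t) := by
    rw [hDB]; field_simp
  rw [hB']
  unfold QA
  have hPe : Psi q γ t = f1 q γ t ^ 2 - 2 * f q γ t * f2 q γ t := rfl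
  generalize f1 q γ t = F1 at *
  generalize f2 q γ t = F2 at *
  generalize Psi q γ t = P at *
  generalize hDe : t * F1 - (q / 2 + 1) * f q γ t = D at *
  generalize √(f q γ t) = s at *
  generalize f q γ t = F at *
  generalize t ^ (q / 2) = A at *
  generalize q / 2 * t ^ (q / 2 - 1) = B at *
  subst hff
  have e : 1 / (t * s) / (D / (A * t * t)) = A * t / (s * D) := by field_simp
  rw [e]
  have e2 : A * t / (s * D) + (-A * F1 + 2 * B * s ^ 2) / (s * P) =
      s * ((-2 * t * A * F2 + (q / 2 + 1) * A * F1 + 2 * t * B * F1 - 2 * (q / 2 + 1) * B * s ^ 2) / (P * D)) := by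
    rw [div_add_div _ _ (mul_ne_zero hs h4) (mul_ne_zero hs h3), mul_div_assoc', div_eq_div_iff
      (mul_ne_zero (mul_ne_zero hs h4) (mul_ne_zero hs h3)) (mul_ne_zero h3 h4), hPe, ← hDe]
    ring
  have e3 : 2 * β * (s ^ 2 * s * F2) / P = s * (2 * β * (s ^ 2 * F2) / P) := by
    field_simp
  rw [e3, mul_sub, ← e2]
  ring

theorem phiB_pos (q t : ℝ) (hq : 2 < q) (ht : 0 < t) (h : t < 1 + 2 / q) : 0 < phiB q t := by
  refine mul_pos (Real.rpow_pos_of_pos ht _) ?_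
  have : q / 2 * t < q / 2 * (1 + 2 / q) := mul_lt_mul_of_pos_left h (by linarith)
  have e : q / 2 * (1 + 2 / q) = q / 2 + 1 := by field_simp
  linarith

theorem phiB_neg (q t : ℝ) (hq : 2 < q) (h : 1 + 2 / q < t) : phiB q t < 0 := by
  have ht : 0 < t := lt_trans (by positivity) h
  refine mul_neg_of_pos_of_neg (Real.rpow_pos_of_pos ht _) ?_
  have : q / 2 * (1 + 2 / q) < q / 2 * t := mul_lt_mul_of_pos_left h (by linarith)
  have e : q / 2 * (1 + 2 / q) = q / 2 + 1 := by field_simp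
  linarith

theorem phi_mono (q : ℝ) (hq : 2 < q) : StrictMonoOn (phiA q) (Ioc 0 (1 + 2 / q)) := by
  refine strictMonoOn_of_deriv_pos (convex_Ioc _ _)
    (fun t ht => (hd_phi q t ht.1).continuousAt.continuousWithinAt) fun t ht => ?_
  rw [interior_Ioc] at ht
  rw [(hd_phi q t ht.1).deriv]
  exact phiB_pos q t hq ht.1 ht.2

theorem phi_anti (q : ℝ) (hq : 2 < q) : StrictAntiOn (phiA q) (Ici (1 + 2 / q)) := by
  have h0 : 0 < 1 + 2 / q := by positivity
  refine strictAntiOn_of_deriv_neg (convex_Ici _)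
    (fun t ht => (hd_phi q t (lt_of_lt_of_le h0 ht)).continuousAt.continuousWithinAt) fun t ht => ?_
  rw [interior_Ici] at ht
  rw [(hd_phi q t (lt_trans h0 ht)).deriv]
  exact phiB_neg q t hq ht

/-- Smoothness of the auxiliary functions away from the maximum point. -/
theorem smooth_g (q : ℝ) (hq : 2 < q) : ∃ g' k h : ℝ → ℝ, ∀ s : Set ℝ,
    (∀ t ∈ s, 0 < t ∧ phiB q t ≠ 0) →
    (∀ t ∈ s, HasDerivAt (fun t => wA q t / phiB q t) (g' t) t) ∧
    (∀ t ∈ s, HasDerivAt k (h t) t) ∧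
    (∀ t ∈ s, g' t = k t * phiB q t) ∧ ContinuousOn h s := by
  set O : Set ℝ := Ioi 0 ∩ {t | (q / 2 + 1) - q / 2 * t ≠ 0} with hO
  have hOo : IsOpen O := isOpen_Ioi.inter (isOpen_ne_fun (by fun_prop) (by fun_prop))
  have hB : ContDiffOn ℝ 3 (phiB q) O := by
    refine ContDiffOn.mul (fun t ht => ?_) (by fun_prop)
    exact (Real.contDiffAt_rpow_const_of_ne (ne_of_gt ht.1)).contDiffWithinAt
  have hBne : ∀ t ∈ O, phiB q t ≠ 0 := fun t ht =>
    mul_ne_zero (Real.rpow_pos_of_pos ht.1 _).ne' ht.2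
  have hw : ContDiffOn ℝ 3 (wA q) O := fun t ht =>
    (Real.contDiffAt_rpow_const_of_ne (ne_of_gt ht.1)).contDiffWithinAt
  have hg : ContDiffOn ℝ 3 (fun t => wA q t / phiB q t) O := hw.div hB hBne
  have hg' : ContDiffOn ℝ 2 (deriv (fun t => wA q t / phiB q t)) O :=
    hg.deriv_of_isOpen hOo (by norm_num)
  have hk : ContDiffOn ℝ 2 (fun t => deriv (fun t => wA q t / phiB q t) t / phiB q t) O :=
    hg'.div (hB.of_le (by norm_num)) hBne
  have hh : ContDiffOn ℝ 1 (deriv (fun t => deriv (fun t => wA q t / phiB q t) t / phiB q t)) O :=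
    hk.deriv_of_isOpen hOo (by norm_num)
  refine ⟨deriv (fun t => wA q t / phiB q t),
    fun t => deriv (fun t => wA q t / phiB q t) t / phiB q t,
    deriv (fun t => deriv (fun t => wA q t / phiB q t) t / phiB q t), fun s hs => ?_⟩
  have hsO : s ⊆ O := fun t ht => ⟨(hs t ht).1, fun h0 => (hs t ht).2 (by
    unfold phiB; rw [h0, mul_zero])⟩
  refine ⟨fun t ht => ?_, fun t ht => ?_, fun t ht => ?_, hh.continuousOn.mono hsO⟩
  · exact ((hg.contDiffAt (hOo.mem_nhds (hsO ht))).differentiableAt (by norm_num)).hasDerivAt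
  · exact ((hk.contDiffAt (hOo.mem_nhds (hsO ht))).differentiableAt (by norm_num)).hasDerivAt
  · have := (hs t ht).2
    field_simp

theorem cont_T (q γ β : ℝ) (s : Set ℝ) (hs : ∀ t ∈ s, 0 < t ∧ 0 < Psi q γ t) :
    ContinuousOn (fun t => √(f q γ t) * f1 q γ t / Psi q γ t ^ 2 * Hb q γ β t) s := by
  intro t ht
  obtain ⟨h0, hP⟩ := hs t ht
  have c0 := (hd_f q γ t h0).continuousAt
  have c1 := (hd_f1 q γ t h0).continuousAt
  have c2 := (hd_f2 q γ t h0).continuousAt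
  have cP := (hd_Psi q γ t h0).continuousAt
  have cC := (hd_rpow (q / 2 - 2) t h0).continuousAt
  have c3 : ContinuousAt (f3 q γ) t := by
    have : ContinuousAt (fun t : ℝ =>
        -(γ * (q / 2 + 1)) * (q / 2 * (q / 2 - 1) * t ^ (q / 2 - 2))) t :=
      continuousAt_const.mul (continuousAt_const.mul cC)
    refine this.congr ?_
    filter_upwards [Ioi_mem_nhds h0] with u hu using (f3_eq q γ u hu).symm
  have cH : ContinuousAt (Hb q γ β) t := by
    unfold Hb
    fun_prop
  exact (((c0.sqrt.mul c1).div (cP.pow 2) (pow_ne_zero 2 hP.ne')).mul cH).continuousWithinAt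

/-- For `q > 2`, `γ ∈ (0, γ_max)` and arbitrary `β ∈ ℝ`, `M_q` is differentiable at `γ`
with `M_q'(γ) = ∫_{t₁}^{t₂} (√f·f'/Ψ²)·H_β dt`. -/
theorem M_deriv_formula (q γ β : ℝ) (hq : 2 < q) (hγ : γ ∈ Ioo 0 (gammaMax q))
    (t₁ t₂ M : ℝ → ℝ) (ht : AreRoots q t₁ t₂) (hM : IsM q t₁ t₂ M) :
    HasDerivAt M
      (∫ t in (t₁ γ)..(t₂ γ),
        Real.sqrt (f q γ t) * f1 q γ t / Psi q γ t ^ 2 * Hb q γ β t) γ := by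
  have hγ0 : 0 < γ := hγ.1
  set t₀ : ℝ := 1 + 2 / q with ht₀
  have ht0 : 1 < t₀ := by
    have : 0 < 2 / q := by positivity
    linarith
  have hmono := phi_mono q hq
  have hanti := phi_anti q hq
  have hroot : ∀ x t : ℝ, 0 < t → f q x t = 0 → phiA q t = x := by
    intro x t h h0
    rw [f_eq q x t h] at h0
    have := (mul_eq_zero.1 h0).resolve_left (Real.rpow_pos_of_pos h _).ne'
    linarith
  have hloc : ∀ x ∈ Ioo 0 (gammaMax q), 1 < t₁ x ∧ t₁ x < t₀ ∧ t₀ < t₂ x ∧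
      phiA q (t₁ x) = x ∧ phiA q (t₂ x) = x := by
    intro x hx
    obtain ⟨h1, h2, h3, h4, -⟩ := ht x hx
    have e1 := hroot x _ h1 h3
    have e2 := hroot x _ (h1.trans h2) h4
    refine ⟨?_, ?_, ?_, e1, e2⟩
    · by_contra hcon
      push Not at hcon
      have : phiA q (t₁ x) ≤ 0 :=
        mul_nonpos_of_nonpos_of_nonneg (by linarith) (Real.rpow_nonneg h1.le _)
      have := hx.1
      linarith
    · by_contra hcon
      push Not at hcon
      have := hanti (show t₁ x ∈ Ici t₀ from hcon) (show t₂ x ∈ Ici t₀ from hcon.trans h2.le) h2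
      linarith
    · by_contra hcon
      push Not at hcon
      have := hmono (show t₁ x ∈ Ioc 0 t₀ from ⟨h1, h2.le.trans hcon⟩)
        (show t₂ x ∈ Ioc 0 t₀ from ⟨h1.trans h2, hcon⟩) h2
      linarith
  obtain ⟨L1, L2, L3, L4, L5⟩ := hloc γ hγ
  have hgt : ∀ t ∈ Ioo (t₁ γ) (t₂ γ), γ < phiA q t := by
    intro t htt
    rcases le_total t t₀ with h | h
    · have := hmono (show t₁ γ ∈ Ioc 0 t₀ from ⟨by linarith, L2.le⟩)
        (show t ∈ Ioc 0 t₀ from ⟨by linarith [htt.1], h⟩) htt.1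
      linarith
    · have := hanti (show t ∈ Ici t₀ from h) (show t₂ γ ∈ Ici t₀ from L3.le) htt.2
      linarith
  have hfpos : ∀ t ∈ Ioo (t₁ γ) (t₂ γ), 0 < f q γ t := by
    intro t htt
    have h0 : 0 < t := by linarith [htt.1]
    rw [f_eq q γ t h0]
    exact mul_pos (Real.rpow_pos_of_pos h0 _) (by linarith [hgt t htt])
  obtain ⟨hr1, hr12, hr3, hr4, -⟩ := ht γ hγ
  have hB1 : phiB q (t₁ γ) ≠ 0 := (phiB_pos q _ hq hr1 L2).ne'
  have hB2 : phiB q (t₂ γ) ≠ 0 := (phiB_neg q _ hq L3).ne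
  have hPsi : ∀ t ∈ Icc (t₁ γ) (t₂ γ), 0 < Psi q γ t := by
    intro t htt
    have h0 : 0 < t := by linarith [htt.1]
    rcases htt.1.eq_or_lt with h1 | h1
    · rw [← h1]
      exact Psi_pos q γ _ hq hγ0 hr1 hr3.ge (fun _ => hB1)
    rcases htt.2.eq_or_lt with h2 | h2
    · rw [h2]
      exact Psi_pos q γ _ hq hγ0 (hr1.trans hr12) hr4.ge (fun _ => hB2)
    · have := hfpos t ⟨h1, h2⟩
      exact Psi_pos q γ t hq hγ0 h0 this.le (fun h => absurd h this.ne')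
  set T : ℝ → ℝ := fun t => Real.sqrt (f q γ t) * f1 q γ t / Psi q γ t ^ 2 * Hb q γ β t with hTdef
  have hTc : ContinuousOn T (Icc (t₁ γ) (t₂ γ)) :=
    cont_T q γ β _ (fun t htt => ⟨by linarith [htt.1], hPsi t htt⟩)
  have hQd : ∀ t ∈ Ioo (t₁ γ) (t₂ γ), HasDerivAt (QA q γ β)
      (wA q t / (2 * (phiA q t - γ) * √(phiA q t - γ)) - T t) t := fun t htt =>
    hd_Q q γ β t (by linarith [htt.1]) (hfpos t htt) (hPsi t (Ioo_subset_Icc_self htt))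
  -- choice of the splitting points
  obtain ⟨c, hc1, hc2⟩ := exists_between L2
  obtain ⟨d, hd1, hd2⟩ := exists_between L3
  have hcd : c < d := hc2.trans hd1
  have hΓ : ∀ᶠ x in nhds γ, x ∈ Ioo 0 (gammaMax q) := Ioo_mem_nhds hγ.1 hγ.2
  have hcγ : γ < phiA q c := hgt c ⟨hc1, by linarith⟩
  have hdγ : γ < phiA q d := hgt d ⟨by linarith, hd2⟩
  have hbγ : phiA q (t₂ γ + 1) < γ := by
    have := hanti (show t₂ γ ∈ Ici t₀ from L3.le) (show t₂ γ + 1 ∈ Ici t₀ by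
      simp only [mem_Ici]; linarith) (by linarith)
    linarith
  have hτ1 : ∀ᶠ x in nhds γ, 1 < t₁ x ∧ t₁ x < c ∧ phiA q (t₁ x) = x := by
    filter_upwards [hΓ, Iio_mem_nhds hcγ] with x hx hxc
    obtain ⟨a1, a2, a3, a4, a5⟩ := hloc x hx
    refine ⟨a1, ?_, a4⟩
    by_contra hcon
    push Not at hcon
    have := hmono.monotoneOn (show c ∈ Ioc 0 t₀ from ⟨by linarith, hc2.le⟩)
      (show t₁ x ∈ Ioc 0 t₀ from ⟨by linarith, a2.le⟩) hcon
    have : x < phiA q c := hxc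
    linarith
  have hτ2 : ∀ᶠ x in nhds γ, d < t₂ x ∧ t₂ x < t₂ γ + 1 ∧ phiA q (t₂ x) = x := by
    filter_upwards [hΓ, Iio_mem_nhds hdγ, Ioi_mem_nhds hbγ] with x hx hxd hxb
    obtain ⟨a1, a2, a3, a4, a5⟩ := hloc x hx
    have hxd : x < phiA q d := hxd
    have hxb : phiA q (t₂ γ + 1) < x := hxb
    refine ⟨?_, ?_, a5⟩
    · by_contra hcon
      push Not at hcon
      have := hanti.antitoneOn (show t₂ x ∈ Ici t₀ from a3.le) (show d ∈ Ici t₀ from hd1.le) hcon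
      linarith
    · by_contra hcon
      push Not at hcon
      have := hanti.antitoneOn (show t₂ γ + 1 ∈ Ici t₀ by simp only [mem_Ici]; linarith)
        (show t₂ x ∈ Ici t₀ from a3.le) hcon
      linarith
  obtain ⟨g', k, h, hsm⟩ := smooth_g q hq
  obtain ⟨s1, s2, s3, s4⟩ := hsm (Icc 1 c) (fun t htt => ⟨by linarith [htt.1],
    (phiB_pos q t hq (by linarith [htt.1]) (by linarith [htt.2])).ne'⟩)
  obtain ⟨r1, r2, r3, r4⟩ := hsm (Icc d (t₂ γ + 1)) (fun t htt => ⟨by linarith [htt.1],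
    (phiB_neg q t hq (by linarith [htt.1])).ne⟩)
  have hleft := aux_left (phiA q) (phiB q) (fun t => wA q t / phiB q t) g' k h (wA q) (QA q γ β) T t₁
    1 c γ (fun t htt => hd_phi q t (by linarith [htt.1])) s1 s2
    (fun t htt => phiB_pos q t hq (by linarith [htt.1]) (by linarith [htt.2]))
    (fun t htt => by
      have := (phiB_pos q t hq (by linarith [htt.1]) (by linarith [htt.2])).ne'
      field_simp) s3 s4 hτ1
    (fun t htt => hQd t ⟨htt.1, by linarith [htt.2]⟩)
    (hTc.mono (Icc_subset_Icc_right (by linarith)))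
    (lim_Q q γ β _ hr1 hr3 hB1 (hPsi _ ⟨le_rfl, hr12.le⟩) _ nhdsWithin_le_nhds (by
      filter_upwards [Ioo_mem_nhdsGT hr12] with t htt using hfpos t htt))
  have hright := aux_right (phiA q) (phiB q) (fun t => wA q t / phiB q t) g' k h (wA q) (QA q γ β) T t₂
    (t₂ γ + 1) d γ (fun t htt => hd_phi q t (by linarith [htt.1])) r1 r2
    (fun t htt => phiB_neg q t hq (by linarith [htt.1]))
    (fun t htt => by
      have := (phiB_neg q t hq (by linarith [htt.1])).ne
      field_simp) r3 r4 hτ2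
    (fun t htt => hQd t ⟨by linarith [htt.1], htt.2⟩)
    (hTc.mono (Icc_subset_Icc_left (by linarith)))
    (lim_Q q γ β _ (hr1.trans hr12) hr4 hB2 (hPsi _ ⟨hr12.le, le_rfl⟩) _ nhdsWithin_le_nhds (by
      filter_upwards [Ioo_mem_nhdsLT hr12] with t htt using hfpos t htt))
  -- the middle part
  have hsubI : Icc c d ⊆ Ioo (t₁ γ) (t₂ γ) := fun t htt =>
    ⟨by linarith [htt.1], by linarith [htt.2]⟩
  have hφc : ContinuousOn (phiA q) (Icc c d) := fun t htt =>
    (hd_phi q t (by linarith [htt.1])).continuousAt.continuousWithinAt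
  have hwc : ContinuousOn (wA q) (Icc c d) := fun t htt =>
    (hd_rpow _ t (by linarith [htt.1])).continuousAt.continuousWithinAt
  obtain ⟨m, hm, hmin⟩ := isCompact_Icc.exists_isMinOn (nonempty_Icc.2 hcd.le) hφc
  have hmγ : γ < phiA q m := hgt m (hsubI hm)
  set δ := (phiA q m - γ) / 2 with hδ
  have hδ0 : 0 < δ := by linarith
  have hy : ∀ x ∈ Icc (γ - δ) (γ + δ), ∀ t ∈ Icc c d, 0 < phiA q t - x := by
    intro x hx t htt
    have : phiA q m ≤ phiA q t := hmin htt
    linarith [hx.2]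
  have hmidc : ∀ x ∈ Icc (γ - δ) (γ + δ),
      ContinuousOn (fun t => wA q t / √(phiA q t - x)) (Icc c d) := fun x hx =>
    hwc.div (hφc.sub continuousOn_const).sqrt (fun t htt => (Real.sqrt_pos.2 (hy x hx t htt)).ne')
  have hmid := aux_param (fun x t => wA q t / √(phiA q t - x))
    (fun x t => wA q t / (2 * (phiA q t - x) * √(phiA q t - x))) c d γ δ hδ0 hcd.le hmidc (by
      have p1 : ContinuousOn (fun z : ℝ × ℝ => phiA q z.2) (Icc (γ - δ) (γ + δ) ×ˢ Icc c d) :=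
        hφc.comp continuousOn_snd (fun z hz => hz.2)
      have p2 : ContinuousOn (fun z : ℝ × ℝ => wA q z.2) (Icc (γ - δ) (γ + δ) ×ˢ Icc c d) :=
        hwc.comp continuousOn_snd (fun z hz => hz.2)
      have p3 := p1.sub (continuousOn_fst (s := Icc (γ - δ) (γ + δ) ×ˢ Icc c d))
      refine p2.div ((continuousOn_const.mul p3).mul p3.sqrt) (fun z hz => ?_)
      have := hy z.1 hz.1 z.2 hz.2
      have := Real.sqrt_pos.2 this
      positivity) (by
      intro x hx t htt
      have hyy := hy x hx t htt
      have hs := Real.sqrt_pos.2 hyy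
      have d0 : HasDerivAt (fun x => phiA q t - x) (-1) x := by
        simpa using (hasDerivAt_id x).const_sub (phiA q t)
      refine ((hasDerivAt_const x (wA q t)).div (d0.sqrt hyy.ne') hs.ne').congr_deriv ?_
      rw [Real.sq_sqrt hyy.le]
      field_simp
      ring)
  have hmidval : ∫ t in c..d, wA q t / (2 * (phiA q t - γ) * √(phiA q t - γ))
      = (∫ t in c..d, T t) + (QA q γ β d - QA q γ β c) := by
    have hγm : γ ∈ Icc (γ - δ) (γ + δ) := ⟨by linarith, by linarith⟩
    have i1 : IntervalIntegrable (fun t => wA q t / (2 * (phiA q t - γ) * √(phiA q t - γ)))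
        volume c d := by
      refine ContinuousOn.intervalIntegrable ?_
      rw [uIcc_of_le hcd.le]
      have p3 := hφc.sub (continuousOn_const (c := γ))
      refine hwc.div ((continuousOn_const.mul p3).mul p3.sqrt) (fun t htt => ?_)
      have := hy γ hγm t htt
      have := Real.sqrt_pos.2 this
      positivity
    have i2 : IntervalIntegrable T volume c d :=
      (hTc.mono (by rw [uIcc_of_le hcd.le]; exact hsubI.trans Ioo_subset_Icc_self)).intervalIntegrable
    have hftc := intervalIntegral.integral_eq_sub_of_hasDerivAt (f := QA q γ β)
      (a := c) (b := d) (fun t htt => hQd t (hsubI (by rwa [uIcc_of_le hcd.le] at htt))) (i1.sub i2)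
    rw [intervalIntegral.integral_sub i1 i2] at hftc
    linarith
  rw [hmidval] at hmid
  have hsum := (hleft.2.add hmid).add hright.2
  have hev : M =ᶠ[nhds γ] fun x => (∫ t in (t₁ x)..c, wA q t / √(phiA q t - x)) +
      (∫ t in c..d, wA q t / √(phiA q t - x)) + ∫ t in d..(t₂ x), wA q t / √(phiA q t - x) := by
    filter_upwards [hΓ, hleft.1, hright.1, Icc_mem_nhds (show γ - δ < γ by linarith)
      (show γ < γ + δ by linarith)] with x hx i1 i3 hxδ
    have i2 : IntervalIntegrable (fun t => wA q t / √(phiA q t - x)) volume c d :=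
      ((hmidc x hxδ).mono (by rw [uIcc_of_le hcd.le])).intervalIntegrable
    rw [intervalIntegral.integral_add_adjacent_intervals i1 i2,
      intervalIntegral.integral_add_adjacent_intervals (i1.trans i2) i3, hM x hx]
    obtain ⟨a1, a2, a3, a4, a5⟩ := hloc x hx
    refine intervalIntegral.integral_congr fun t htt => ?_
    rw [uIcc_of_le (by linarith)] at htt
    exact (w_eq q x t (by linarith [htt.1])).symm
  refine (hsum.congr_of_eventuallyEq hev).congr_deriv ?_
  have j : ∀ u v, t₁ γ ≤ u → u ≤ v → v ≤ t₂ γ → IntervalIntegrable T volume u v := by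
    intro u v h1 h2 h3
    exact (hTc.mono (by rw [uIcc_of_le h2]; exact Icc_subset_Icc h1 h3)).intervalIntegrable
  have j1 := j (t₁ γ) c le_rfl hc1.le (by linarith)
  have j2 := j c d hc1.le hcd.le hd2.le
  have j3 := j d (t₂ γ) (by linarith) hd2.le le_rfl
  rw [← intervalIntegral.integral_add_adjacent_intervals (j1.trans j2) j3,
    ← intervalIntegral.integral_add_adjacent_intervals j1 j2]
  ring
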